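/- Let n ≥ 2 and let I be a permutation of {1,…,n}. Every coefficient c_d(a) of z^d in the vertex function V_I(u,z) is a rational function over ℚ(q,ħ) of a_1,…,a_{n−1}, where a_i = u_i/u_{i+1}; the limit c_d(0) = lim_{a_1,…,a_{n−1} → 0} c_d(a) exists; and, as formal power series in z_1,…,z_{n−1} over ℚ(q,ħ), ∑_{d∈C} c_d(0) z^d = ∏_{1≤j<k≤n} φ(q (ħ/q)^{k−j+δ(I_j<I_k)} z_j⋯z_{k−1}) / φ((ħ/q)^{k−j−1+δ(I_j<I_k)} z_j⋯z_{k−1}), where δ(a<b)=1 if a<b, else 0, and each φ-factor of a monomial argument is expanded as the formal power series ∏_{i=0}^∞(1 − c q^i z_j⋯z_{k−1}) for the relevant constant c. (Under the 3d-mirror identification κ: ħ ↦ q/ħ^!, z_i ↦ ħ^! a_i^!, this limit V_I(0,z) becomes Φ((q−ħ^!)N^{!+}_{I^{−1}}), the attracting-part normalization factor of the dual vertex function at the fixed point I^{−1}.) -/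

import Mathlib

noncomputable section
open scoped BigOperators

/-- `φ(x) = ∏_{i=0}^∞ (1 − x qⁱ)`. -/
def phiP (q x : ℂ) : ℂ := ∏' i : ℕ, (1 - x * q ^ i)

/-- The odd Jacobi theta function `ϑ(x) = (x^{1/2} − x^{−1/2}) φ(qx) φ(q/x)`,
expressed in terms of the chosen square root `y = x^{1/2}` of `x = y²`. -/
def thetaH (q y : ℂ) : ℂ := (y - y⁻¹) * phiP q (q * y ^ 2) * phiP q (q / y ^ 2)
/-- The (0-based) value `I_{k+1} - 1` of a permutation `I` of `{1,…,n}` at the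
(0-based) position `k`; junk value `0` if `k ≥ n`. -/
def pval (n : ℕ) (I : Equiv.Perm (Fin n)) (k : ℕ) : ℕ :=
  if h : k < n then ((I ⟨k, h⟩ : Fin n) : ℕ) else 0

/-- The `a`-th smallest (0-based position `a`) element of `{I_1,…,I_k}`, with all
values recorded 0-based: this is `i^{(k)}_{a+1} - 1` in the notation of the paper. -/
def ordIdx (n : ℕ) (I : Equiv.Perm (Fin n)) (k a : ℕ) : ℕ :=
  (((Finset.range k).image (pval n I)).sort (· ≤ ·)).getD a 0

/-- `j(I,k,a)`: the 0-based position `j` with `I_j = i^{(k)}_a`. -/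
def jIdx (n : ℕ) (I : Equiv.Perm (Fin n)) (k a : ℕ) : ℕ :=
  if h : ordIdx n I k a < n then ((I.symm ⟨ordIdx n I k a, h⟩ : Fin n) : ℕ) else 0

/-- The set of pairs `(j,k)` of 0-based indices with `0 ≤ j < k ≤ n-1`. -/
def pairsN (n : ℕ) : Finset (ℕ × ℕ) :=
  (Finset.range n ×ˢ Finset.range n).filter (fun p => p.1 < p.2)

/-- The order `I ≺ J`:  `i^{(k)}_m ≤ j^{(k)}_m` for all `1 ≤ k ≤ n-1`, `1 ≤ m ≤ k`. -/
def prec (n : ℕ) (I J : Equiv.Perm (Fin n)) : Prop :=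
  ∀ k, 1 ≤ k → k ≤ n - 1 → ∀ m, m < k → ordIdx n I k m ≤ ordIdx n J k m
/-- The q-Pochhammer symbol `(x)_d = φ(x)/φ(xq^d)` for `d ∈ ℤ`:
`(x)_d = ∏_{i=0}^{d−1}(1−xqⁱ)` for `d ≥ 0` and `(x)_d = ∏_{i=1}^{−d}(1−xq^{−i})⁻¹`
for `d < 0`. -/
def qPoch (q x : ℂ) (d : ℤ) : ℂ :=
  if 0 ≤ d then ∏ i ∈ Finset.range d.toNat, (1 - x * q ^ i)
  else (∏ i ∈ Finset.range (-d).toNat, (1 - x * q ^ (-(i : ℤ) - 1)))⁻¹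

/-- Degree data for quasimaps to the cotangent bundle of the complete flag variety of
`ℂⁿ`: a tuple of nonnegative integers `d_{i,j}`, `1 ≤ i ≤ n-1`, `1 ≤ j ≤ i`, recorded
0-based (entries with `j > i` are irrelevant and required to vanish for admissibility). -/
def Deg (n : ℕ) : Type := Fin (n - 1) → Fin (n - 1) → ℕ

/-- The entry `d_{i+1,j+1}` of a degree tuple (0-based accessor; junk `0` out of range). -/
def dd (n : ℕ) (d : Deg n) (i j : ℕ) : ℕ :=
  if h : i < n - 1 ∧ j < n - 1 then d ⟨i, h.1⟩ ⟨j, h.2⟩ else 0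

/-- The set `C` of admissible degrees: `d_{i,j} = 0` for `j > i`, and for each
`1 ≤ i ≤ n-2` there exist distinct `j_1,…,j_i ∈ {1,…,i+1}` with `d_{i,k} ≥ d_{i+1,j_k}`. -/
def admissible (n : ℕ) (d : Deg n) : Prop :=
  (∀ i j, i < j → dd n d i j = 0) ∧
  (∀ i, i + 1 < n - 1 → ∃ f : ℕ → ℕ, Set.InjOn f (Set.Iio (i + 1)) ∧
    ∀ k, k < i + 1 → f k < i + 2 ∧ dd n d (i + 1) (f k) ≤ dd n d i k)

/-- The coefficient of `z^d` in the vertex function of the cotangent bundle of the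
complete flag variety at the fixed point `I` ([KorZet] Theorem 3.1). -/
def vTerm (n : ℕ) (I : Equiv.Perm (Fin n)) (q h : ℂ) (u : ℕ → ℂ) (d : Deg n) : ℂ :=
  (∏ i ∈ Finset.range (n - 2), ∏ j ∈ Finset.range (i + 1), ∏ k ∈ Finset.range (i + 2),
      qPoch q (h * u (pval n I k) / u (pval n I j)) ((dd n d i j : ℤ) - dd n d (i + 1) k) /
        qPoch q (q * u (pval n I k) / u (pval n I j)) ((dd n d i j : ℤ) - dd n d (i + 1) k)) *
  (∏ i ∈ Finset.range (n - 1), ∏ j ∈ Finset.range (i + 1), ∏ k ∈ Finset.range (i + 1),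
      qPoch q (q * u (pval n I k) / u (pval n I j)) ((dd n d i j : ℤ) - dd n d i k) /
        qPoch q (h * u (pval n I k) / u (pval n I j)) ((dd n d i j : ℤ) - dd n d i k)) *
  (∏ i ∈ Finset.range n, ∏ j ∈ Finset.range (n - 1),
      qPoch q (h * u i / u (pval n I j)) (dd n d (n - 2) j) /
        qPoch q (q * u i / u (pval n I j)) (dd n d (n - 2) j))

/-- The monomial `z^d = ∏_{i,j} z_i^{d_{i,j}}`. -/
def zMon (n : ℕ) (z : ℕ → ℂ) (d : Deg n) : ℂ :=
  ∏ i ∈ Finset.range (n - 1), z i ^ (∑ j ∈ Finset.range (i + 1), dd n d i j)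

/-- The value of the vertex function `V_I(u,z) = ∑_{d ∈ C} c_d(u) z^d`. -/
def Vval (n : ℕ) (I : Equiv.Perm (Fin n)) (q h : ℂ) (u z : ℕ → ℂ) : ℂ :=
  ∑' d : Deg n,
    Set.indicator {d : Deg n | admissible n d} (fun d => vTerm n I q h u d * zMon n z d) d

/-- The point of the equivariant torus determined by the chamber coordinates
`a_i = u_i/u_{i+1}`:  `u_i := a_i a_{i+1} ⋯ a_{n-1}` (so `u_n = 1`). -/
def uOf (n : ℕ) (a : Fin (n - 1) → ℂ) : ℕ → ℂ := fun i =>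
  ∏ k ∈ Finset.Ico i (n - 1), (if hk : k < n - 1 then a ⟨k, hk⟩ else 1)
/-! ### The q-binomial theorem -/

lemma aux_mult (q x : ℂ) (hq1 : ‖q‖ < 1) :
    Filter.Tendsto (fun N => ∏ i ∈ Finset.range N, (1 - x * q ^ i)) Filter.atTop
      (nhds (phiP q x)) := by
  have hs : Summable (fun i : ℕ => ‖-(x * q ^ i)‖) := by
    simp only [norm_neg, norm_mul, norm_pow]
    exact (summable_geometric_of_lt_one (norm_nonneg _) hq1).mul_left _
  have := (multipliable_one_add_of_summable hs).hasProd.tendsto_prod_nat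
  simpa [phiP, sub_eq_add_neg] using this

lemma one_sub_mul_pow_ne (q x : ℂ) (hq1 : ‖q‖ < 1) (hx : ‖x‖ < 1) (i : ℕ) :
    1 - x * q ^ i ≠ 0 := by
  intro h0
  have h1 : x * q ^ i = 1 := (sub_eq_zero.mp h0).symm
  have h2 : ‖x * q ^ i‖ = 1 := by rw [h1]; simp
  rw [norm_mul, norm_pow] at h2
  have h3 : ‖q‖ ^ i ≤ 1 := pow_le_one₀ (norm_nonneg _) hq1.le
  have h4 : 0 ≤ ‖q‖ ^ i := pow_nonneg (norm_nonneg _) _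
  nlinarith [norm_nonneg x]

lemma phiP_ne_zero (q x : ℂ) (hq1 : ‖q‖ < 1) (hx : ‖x‖ < 1) : phiP q x ≠ 0 := by
  have hs : Summable (fun i : ℕ => ‖-(x * q ^ i)‖) := by
    simp only [norm_neg, norm_mul, norm_pow]
    exact (summable_geometric_of_lt_one (norm_nonneg _) hq1).mul_left _
  have := tprod_one_add_ne_zero_of_summable (f := fun i : ℕ => -(x * q ^ i))
    (fun i => by
      have := one_sub_mul_pow_ne q x hq1 hx i
      simpa [sub_eq_add_neg] using this) hs
  simpa [phiP, sub_eq_add_neg] using this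

/-- The diagonal ratio `(ħ)_D/(q)_D`. -/
def cc (q h : ℂ) (D : ℤ) : ℂ := qPoch q h D / qPoch q q D

lemma qPoch_nat (q x : ℂ) (m : ℕ) :
    qPoch q x (m : ℤ) = ∏ i ∈ Finset.range m, (1 - x * q ^ i) := by
  simp [qPoch]

lemma cc_zero (q h : ℂ) : cc q h 0 = 1 := by simp [cc, qPoch]

lemma cc_neg (q h : ℂ) (hq : q ≠ 0) (D : ℤ) (hD : D < 0) : cc q h D = 0 := by
  have : qPoch q q D = 0 := by
    rw [qPoch, if_neg (by omega), inv_eq_zero]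
    apply Finset.prod_eq_zero (i := 0)
    · simp; omega
    · simp [hq]
  rw [cc, this, div_zero]

lemma cc_succ (q h : ℂ) (hq1 : ‖q‖ < 1) (m : ℕ) :
    cc q h ((m + 1 : ℕ) : ℤ) * (1 - q ^ (m + 1)) = cc q h (m : ℤ) * (1 - h * q ^ m) := by
  have h1 : ∀ i, 1 - q * q ^ i ≠ 0 := fun i => one_sub_mul_pow_ne q q hq1 hq1 i
  have h2 : ∏ i ∈ Finset.range m, (1 - q * q ^ i) ≠ 0 := Finset.prod_ne_zero_iff.mpr fun i _ => h1 i
  have h3 := h1 m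
  rw [cc, cc, qPoch_nat, qPoch_nat, qPoch_nat, qPoch_nat, Finset.prod_range_succ,
    Finset.prod_range_succ, pow_succ']
  generalize ∏ i ∈ Finset.range m, (1 - q * q ^ i) = A at *
  generalize 1 - q * q ^ m = B at *
  field_simp

lemma cc_summable (q h x : ℂ) (hq1 : ‖q‖ < 1) (hx : ‖x‖ < 1) :
    Summable (fun m : ℕ => cc q h (m : ℤ) * x ^ m) := by
  have hqt : Filter.Tendsto (fun m : ℕ => q ^ m) Filter.atTop (nhds 0) :=
    tendsto_pow_atTop_nhds_zero_of_norm_lt_one hq1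
  have ht : Filter.Tendsto (fun m : ℕ => ‖x * ((1 - h * q ^ m) / (1 - q ^ (m + 1)))‖) Filter.atTop
      (nhds ‖x * ((1 - h * 0) / (1 - 0))‖) := by
    apply Filter.Tendsto.norm
    apply Filter.Tendsto.mul tendsto_const_nhds
    apply Filter.Tendsto.div
    · exact tendsto_const_nhds.sub (tendsto_const_nhds.mul hqt)
    · exact tendsto_const_nhds.sub (hqt.comp (Filter.tendsto_add_atTop_nat 1))
    · simp
  simp only [mul_zero, sub_zero, div_one, mul_one] at ht
  obtain ⟨r, hr1, hr2⟩ := exists_between hx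
  have hev := ht.eventually (gt_mem_nhds hr1)
  apply summable_of_ratio_norm_eventually_le hr2
  filter_upwards [hev] with m hm
  have hne : 1 - q ^ (m + 1) ≠ 0 := by
    have := one_sub_mul_pow_ne q q hq1 hq1 m
    rwa [← pow_succ'] at this
  have hc : cc q h ((m + 1 : ℕ) : ℤ) = cc q h (m : ℤ) * ((1 - h * q ^ m) / (1 - q ^ (m + 1))) := by
    have := cc_succ q h hq1 m
    field_simp
    exact this
  have : cc q h ((m + 1 : ℕ) : ℤ) * x ^ (m + 1)
      = (x * ((1 - h * q ^ m) / (1 - q ^ (m + 1)))) * (cc q h (m : ℤ) * x ^ m) := by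
    rw [hc]; ring
  rw [this, norm_mul]
  exact mul_le_mul_of_nonneg_right hm.le (norm_nonneg _)

lemma cc_funeq (q h x : ℂ) (hq1 : ‖q‖ < 1) (hx : ‖x‖ < 1) :
    (1 - x) * ∑' m : ℕ, cc q h (m : ℤ) * x ^ m
      = (1 - h * x) * ∑' m : ℕ, cc q h (m : ℤ) * (x * q) ^ m := by
  have hxq : ‖x * q‖ < 1 := by
    rw [norm_mul]; nlinarith [norm_nonneg x, norm_nonneg q]
  have s1 := cc_summable q h x hq1 hx
  have s2 := cc_summable q h (x * q) hq1 hxq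
  have e1 := s1.tsum_eq_zero_add
  have e2 := s2.tsum_eq_zero_add
  have s1' := (summable_nat_add_iff 1).mpr s1
  have s2' := (summable_nat_add_iff 1).mpr s2
  have k1 : ∑' m : ℕ, cc q h ((m + 1 : ℕ) : ℤ) * x ^ (m + 1) - x * ∑' m : ℕ, cc q h (m : ℤ) * x ^ m
      = ∑' m : ℕ, cc q h ((m + 1 : ℕ) : ℤ) * (x * q) ^ (m + 1)
        - h * x * ∑' m : ℕ, cc q h (m : ℤ) * (x * q) ^ m := by
    rw [← tsum_mul_left, ← tsum_mul_left, ← s1'.tsum_sub (s1.mul_left _),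
      ← s2'.tsum_sub (s2.mul_left _)]
    apply tsum_congr
    intro m
    have := cc_succ q h hq1 m
    simp only [mul_pow]
    linear_combination (x ^ (m + 1)) * this
  have z1 : cc q h ((0 : ℕ) : ℤ) = 1 := cc_zero q h
  simp only [z1, pow_zero, mul_one] at e1 e2
  linear_combination e1 - e2 + k1

lemma qbinomial (q h x : ℂ) (hq1 : ‖q‖ < 1) (hx : ‖x‖ < 1) :
    HasSum (fun m : ℕ => cc q h (m : ℤ) * x ^ m) (phiP q (h * x) / phiP q x) := by
  have s1 := cc_summable q h x hq1 hx
  have hqN : ∀ N : ℕ, ‖q‖ ^ N ≤ 1 := fun N => pow_le_one₀ (norm_nonneg _) hq1.le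
  have hxN : ∀ N : ℕ, ‖x * q ^ N‖ ≤ ‖x‖ := by
    intro N
    rw [norm_mul, norm_pow]
    exact mul_le_of_le_one_right (norm_nonneg _) (hqN N)
  have hit : ∀ N : ℕ, (∏ i ∈ Finset.range N, (1 - x * q ^ i)) * ∑' m : ℕ, cc q h (m : ℤ) * x ^ m
      = (∏ i ∈ Finset.range N, (1 - h * x * q ^ i)) *
        ∑' m : ℕ, cc q h (m : ℤ) * (x * q ^ N) ^ m := by
    intro N
    induction N with
    | zero => simp
    | succ N ih =>
      have := cc_funeq q h (x * q ^ N) hq1 ((hxN N).trans_lt hx)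
      rw [Finset.prod_range_succ, Finset.prod_range_succ, pow_succ, ← mul_assoc x]
      linear_combination (1 - x * q ^ N) * ih +
        (∏ i ∈ Finset.range N, (1 - h * x * q ^ i)) * this
  have hlim : Filter.Tendsto (fun N : ℕ => ∑' m : ℕ, cc q h (m : ℤ) * (x * q ^ N) ^ m)
      Filter.atTop (nhds (∑' m : ℕ, cc q h (m : ℤ) * (0 : ℂ) ^ m)) := by
    apply tendsto_tsum_of_dominated_convergence (bound := fun m : ℕ => ‖cc q h (m : ℤ) * x ^ m‖)
      s1.norm
    · intro m
      apply Filter.Tendsto.mul tendsto_const_nhds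
      apply Filter.Tendsto.pow
      simpa using (tendsto_pow_atTop_nhds_zero_of_norm_lt_one hq1).const_mul x
    · refine Filter.Eventually.of_forall fun N m => ?_
      rw [norm_mul, norm_mul, norm_pow, norm_pow]
      gcongr
      exact hxN N
  have hz : ∑' m : ℕ, cc q h (m : ℤ) * (0 : ℂ) ^ m = 1 := by
    rw [tsum_eq_single 0]
    · simpa using cc_zero q h
    · intro m hm; simp [hm]
  rw [hz] at hlim
  have l1 := (aux_mult q x hq1).mul_const (∑' m : ℕ, cc q h (m : ℤ) * x ^ m)
  have l2 := (aux_mult q (h * x) hq1).mul hlim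
  have := tendsto_nhds_unique (l1.congr hit) l2
  have hv : ∑' m : ℕ, cc q h (m : ℤ) * x ^ m = phiP q (h * x) / phiP q x := by
    rw [eq_div_iff (phiP_ne_zero q x hq1 hx)]
    linear_combination this
  rw [← hv]
  exact s1.hasSum

lemma hasSum_mul_complex {α β : Type*} {f : α → ℂ} {g : β → ℂ} {s t : ℂ} (hf : HasSum f s)
    (hg : HasSum g t) : HasSum (fun x : α × β => f x.1 * g x.2) (s * t) :=
  hf.mul hg (summable_mul_of_summable_norm (summable_norm_iff.mpr hf.summable)
    (summable_norm_iff.mpr hg.summable))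

/-- Product of finitely many convergent series. -/
lemma hasSum_pi_prod {α : Type*} (N : ℕ) : ∀ (F : Fin N → α → ℂ) (S : Fin N → ℂ),
    (∀ i, HasSum (F i) (S i)) → HasSum (fun m : Fin N → α => ∏ i, F i (m i)) (∏ i, S i) := by
  induction N with
  | zero =>
    intro F S _
    simp
  | succ N ih =>
    intro F S hs
    have ih' := ih (fun i => F i.succ) (fun i => S i.succ) (fun i => hs i.succ)
    have h0 := hs 0
    have := hasSum_mul_complex h0 ih'
    rw [Fin.prod_univ_succ, ← (Fin.consEquiv (fun _ => α)).hasSum_iff]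
    have he : ((fun m : Fin (N + 1) → α => ∏ i, F i (m i)) ∘ (Fin.consEquiv (fun _ => α)))
        = fun x : α × (Fin N → α) => F 0 x.1 * ∏ i : Fin N, F i.succ (x.2 i) := by
      funext x
      simp only [Function.comp, Fin.prod_univ_succ]
      rfl
    rw [he]
    exact this

/-! ### Rationality -/

/-- `f` is a rational function of `a` with coefficients in the subalgebra `S`. -/
def IsRat {σ : Type} (S : Subalgebra ℚ ℂ) (f : (σ → ℂ) → ℂ) : Prop :=
  ∃ P Q : MvPolynomial σ ℂ, (∀ m, MvPolynomial.coeff m P ∈ S) ∧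
    (∀ m, MvPolynomial.coeff m Q ∈ S) ∧ Q ≠ 0 ∧
    ∀ a : σ → ℂ, MvPolynomial.eval a Q ≠ 0 → f a * MvPolynomial.eval a Q = MvPolynomial.eval a P

section Rat
variable {σ : Type} {S : Subalgebra ℚ ℂ}

lemma coeffs_mul {P Q : MvPolynomial σ ℂ} (hP : ∀ m, MvPolynomial.coeff m P ∈ S)
    (hQ : ∀ m, MvPolynomial.coeff m Q ∈ S) : ∀ m, MvPolynomial.coeff m (P * Q) ∈ S := by
  classical
  intro m
  rw [MvPolynomial.coeff_mul]
  exact S.sum_mem fun x _ => S.mul_mem (hP _) (hQ _)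

lemma coeffs_C {c : ℂ} (hc : c ∈ S) : ∀ m, MvPolynomial.coeff m (MvPolynomial.C c : MvPolynomial σ ℂ) ∈ S := by
  classical
  intro m
  rw [MvPolynomial.coeff_C]
  split_ifs
  · exact hc
  · exact S.zero_mem

lemma IsRat.const {c : ℂ} (hc : c ∈ S) : IsRat S (fun _ : σ → ℂ => c) :=
  ⟨MvPolynomial.C c, MvPolynomial.C 1, coeffs_C hc, coeffs_C S.one_mem, by simp, by simp⟩

lemma IsRat.X (i : σ) : IsRat S (fun a : σ → ℂ => a i) := by
  classical
  refine ⟨MvPolynomial.X i, MvPolynomial.C 1, ?_, coeffs_C S.one_mem, by simp, by simp⟩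
  intro m
  rw [MvPolynomial.coeff_X]
  split_ifs
  · exact S.one_mem
  · exact S.zero_mem

lemma IsRat.mul {f g : (σ → ℂ) → ℂ} (hf : IsRat S f) (hg : IsRat S g) :
    IsRat S (fun a => f a * g a) := by
  obtain ⟨P, Q, hP, hQ, h0, he⟩ := hf
  obtain ⟨P', Q', hP', hQ', h0', he'⟩ := hg
  refine ⟨P * P', Q * Q', coeffs_mul hP hP', coeffs_mul hQ hQ', mul_ne_zero h0 h0', ?_⟩
  intro a ha
  rw [map_mul] at ha ⊢
  rw [map_mul, ← he a (left_ne_zero_of_mul ha), ← he' a (right_ne_zero_of_mul ha)]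
  ring

lemma IsRat.sub {f g : (σ → ℂ) → ℂ} (hf : IsRat S f) (hg : IsRat S g) :
    IsRat S (fun a => f a - g a) := by
  obtain ⟨P, Q, hP, hQ, h0, he⟩ := hf
  obtain ⟨P', Q', hP', hQ', h0', he'⟩ := hg
  refine ⟨P * Q' - Q * P', Q * Q', ?_, coeffs_mul hQ hQ', mul_ne_zero h0 h0', ?_⟩
  · intro m
    rw [MvPolynomial.coeff_sub]
    exact S.sub_mem (coeffs_mul hP hQ' m) (coeffs_mul hQ hP' m)
  intro a ha
  rw [map_mul] at ha ⊢
  rw [map_sub, map_mul, map_mul, ← he a (left_ne_zero_of_mul ha), ← he' a (right_ne_zero_of_mul ha)]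
  ring

lemma IsRat.inv {f : (σ → ℂ) → ℂ} (hf : IsRat S f) : IsRat S (fun a => (f a)⁻¹) := by
  obtain ⟨P, Q, hP, hQ, h0, he⟩ := hf
  by_cases hP0 : P = 0
  · refine ⟨P, Q, hP, hQ, h0, ?_⟩
    intro a ha
    have := he a ha
    simp only [hP0, map_zero, mul_eq_zero, ha, or_false] at this ⊢
    simp [this]
  · refine ⟨Q * Q, P * Q, coeffs_mul hQ hQ, coeffs_mul hP hQ, mul_ne_zero hP0 h0, ?_⟩
    intro a ha
    rw [map_mul] at ha ⊢
    have h1 := left_ne_zero_of_mul ha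
    have h2 := right_ne_zero_of_mul ha
    have h3 := he a h2
    have h4 : f a ≠ 0 := by
      intro h; rw [h, zero_mul] at h3; exact h1 h3.symm
    rw [map_mul, ← h3]
    field_simp

lemma IsRat.div {f g : (σ → ℂ) → ℂ} (hf : IsRat S f) (hg : IsRat S g) :
    IsRat S (fun a => f a / g a) := by
  simpa only [div_eq_mul_inv] using hf.mul hg.inv

lemma IsRat.prod {ι : Type*} (s : Finset ι) {f : ι → (σ → ℂ) → ℂ} (hf : ∀ i, IsRat S (f i)) :
    IsRat S (fun a => ∏ i ∈ s, f i a) := by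
  classical
  induction s using Finset.induction_on with
  | empty => simpa using IsRat.const S.one_mem
  | insert i s hi ih =>
    simp only [Finset.prod_insert hi]
    exact (hf i).mul ih

lemma IsRat.zpow {f : (σ → ℂ) → ℂ} (hf : IsRat S f) (k : ℤ) : IsRat S (fun a => f a ^ k) := by
  have hnat : ∀ m : ℕ, IsRat S (fun a => f a ^ m) := by
    intro m
    simpa using IsRat.prod (Finset.range m) (f := fun _ => f) (fun _ => hf)
  cases k with
  | ofNat m => simpa using hnat m
  | negSucc m => simpa [zpow_negSucc] using (hnat (m + 1)).inv

lemma IsRat.qPoch {q : ℂ} (hq : q ∈ S) {x : (σ → ℂ) → ℂ} (hx : IsRat S x) (D : ℤ) :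
    IsRat S (fun a => qPoch q (x a) D) := by
  unfold _root_.qPoch
  have h1 : IsRat S (fun _ : σ → ℂ => (1 : ℂ)) := IsRat.const S.one_mem
  have hqc : IsRat S (fun _ : σ → ℂ => q) := IsRat.const hq
  split_ifs
  · exact IsRat.prod _ fun i => h1.sub (hx.mul (by simpa using hqc.zpow (i : ℤ)))
  · exact (IsRat.prod _ fun i => h1.sub (hx.mul (hqc.zpow _))).inv

end Rat

lemma IsRat.uOf {n : ℕ} {S : Subalgebra ℚ ℂ} (i : ℕ) :
    IsRat S (fun a : Fin (n - 1) → ℂ => uOf n a i) := by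
  unfold _root_.uOf
  refine IsRat.prod _ fun k => ?_
  by_cases hk : k < n - 1
  · simpa [hk] using IsRat.X _
  · simpa [hk] using IsRat.const S.one_mem

lemma IsRat.vTerm (n : ℕ) (I : Equiv.Perm (Fin n)) {q h : ℂ} {S : Subalgebra ℚ ℂ} (hq : q ∈ S)
    (hh : h ∈ S) (d : Deg n) :
    IsRat S (fun a : Fin (n - 1) → ℂ => vTerm n I q h (_root_.uOf n a) d) := by
  have key : ∀ (c : ℂ) (_ : c ∈ S) (i j : ℕ) (D : ℤ), IsRat S (fun a : Fin (n - 1) → ℂ =>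
      _root_.qPoch q (c * _root_.uOf n a i / _root_.uOf n a j) D) := fun c hc i j D =>
    IsRat.qPoch hq (((IsRat.const hc).mul (IsRat.uOf i)).div (IsRat.uOf j)) D
  unfold _root_.vTerm
  refine ((IsRat.prod _ fun i => IsRat.prod _ fun j => IsRat.prod _ fun k => ?_).mul
    (IsRat.prod _ fun i => IsRat.prod _ fun j => IsRat.prod _ fun k => ?_)).mul
    (IsRat.prod _ fun i => IsRat.prod _ fun j => ?_)
  · exact (key h hh _ _ _).div (key q hq _ _ _)
  · exact (key q hq _ _ _).div (key h hh _ _ _)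
  · exact (key h hh _ _ _).div (key q hq _ _ _)

/-! ### Limits -/

/-- The ratio `(ħx)_D/(qx)_D`. -/
def RR (q h x : ℂ) (D : ℤ) : ℂ := qPoch q (h * x) D / qPoch q (q * x) D

lemma RR_eq (q h x : ℂ) (D : ℤ) : RR q h x D =
    if 0 ≤ D then ∏ i ∈ Finset.range D.toNat, ((1 - h * x * q ^ (i : ℤ)) / (1 - q * x * q ^ (i : ℤ)))
    else (∏ i ∈ Finset.range (-D).toNat,
      ((1 - h * x * q ^ (-(i : ℤ) - 1)) / (1 - q * x * q ^ (-(i : ℤ) - 1))))⁻¹ := by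
  unfold RR qPoch
  split_ifs
  · simp [Finset.prod_div_distrib]
  · rw [Finset.prod_div_distrib, inv_div_inv, inv_div]

lemma RR_tendsto_zero {β : Type*} {l : Filter β} {x : β → ℂ} (hx : Filter.Tendsto x l (nhds 0))
    (q h : ℂ) (D : ℤ) : Filter.Tendsto (fun b => RR q h (x b) D) l (nhds 1) := by
  have key : ∀ c : ℂ, Filter.Tendsto (fun b => (1 - h * x b * c) / (1 - q * x b * c)) l (nhds 1) := by
    intro c
    have : Filter.Tendsto (fun b => (1 - h * x b * c) / (1 - q * x b * c)) l
        (nhds ((1 - h * 0 * c) / (1 - q * 0 * c))) := by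
      apply Filter.Tendsto.div
      · exact tendsto_const_nhds.sub ((hx.const_mul h).mul_const c)
      · exact tendsto_const_nhds.sub ((hx.const_mul q).mul_const c)
      · simp
    simpa using this
  simp only [RR_eq]
  split_ifs
  · simpa using tendsto_finsetProd (Finset.range D.toNat) (fun i _ => key (q ^ (i : ℤ)))
  · have := (tendsto_finsetProd (Finset.range (-D).toNat)
      (fun i _ => key (q ^ (-(i : ℤ) - 1))))
    simpa using this.inv₀ (by simp)

lemma RR_tendsto_infty {β : Type*} {l : Filter β} {t : β → ℂ} (ht : Filter.Tendsto t l (nhds 0))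
    (ht0 : ∀ᶠ b in l, t b ≠ 0) (q h : ℂ) (hq : q ≠ 0) (hh : h ≠ 0) (D : ℤ) :
    Filter.Tendsto (fun b => RR q h (t b)⁻¹ D) l (nhds ((h / q) ^ D)) := by
  have key : ∀ c : ℂ, c ≠ 0 → Filter.Tendsto
      (fun b => (1 - h * (t b)⁻¹ * c) / (1 - q * (t b)⁻¹ * c)) l (nhds (h / q)) := by
    intro c hc
    have : Filter.Tendsto (fun b => (t b - h * c) / (t b - q * c)) l
        (nhds ((0 - h * c) / (0 - q * c))) := by
      apply Filter.Tendsto.div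
      · exact ht.sub tendsto_const_nhds
      · exact ht.sub tendsto_const_nhds
      · simp [hq, hc]
    have e : (0 - h * c) / (0 - q * c) = h / q := by
      rw [zero_sub, zero_sub, neg_div_neg_eq, mul_div_mul_right _ _ hc]
    rw [e] at this
    refine this.congr' ?_
    filter_upwards [ht0] with b hb
    rw [← mul_div_mul_left (1 - h * (t b)⁻¹ * c) (1 - q * (t b)⁻¹ * c) hb]
    congr 1 <;> field_simp
  simp only [RR_eq]
  split_ifs with hD
  · have := tendsto_finsetProd (Finset.range D.toNat)
      (fun i _ => key (q ^ (i : ℤ)) (zpow_ne_zero _ hq))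
    rw [Finset.prod_const, Finset.card_range, ← zpow_natCast, Int.toNat_of_nonneg hD] at this
    exact this
  · have := tendsto_finsetProd (Finset.range (-D).toNat)
      (fun i _ => key (q ^ (-(i : ℤ) - 1)) (zpow_ne_zero _ hq))
    rw [Finset.prod_const, Finset.card_range, ← zpow_natCast, Int.toNat_of_nonneg (by omega)] at this
    have h2 := this.inv₀ (zpow_ne_zero _ (div_ne_zero hh hq))
    rwa [← zpow_neg, neg_neg] at h2

lemma uOf_ne_zero (n : ℕ) (a : Fin (n - 1) → ℂ) (ha : ∀ i, a i ≠ 0) (i : ℕ) : uOf n a i ≠ 0 := by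
  unfold uOf
  refine Finset.prod_ne_zero_iff.mpr fun k _ => ?_
  split_ifs
  · exact ha _
  · exact one_ne_zero

lemma uOf_ratio_tendsto (n : ℕ) (i j : ℕ) (hij : i < j) (hj : j < n) :
    Filter.Tendsto (fun a : Fin (n - 1) → ℂ => uOf n a i / uOf n a j)
      (nhdsWithin 0 {a | ∀ i, a i ≠ 0}) (nhds 0) := by
  have h1 : Filter.Tendsto (fun a : Fin (n - 1) → ℂ =>
      ∏ k ∈ Finset.Ico i j, (if hk : k < n - 1 then a ⟨k, hk⟩ else 1))
      (nhdsWithin 0 {a | ∀ i, a i ≠ 0})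
      (nhds (∏ k ∈ Finset.Ico i j, (if k < n - 1 then 0 else 1))) := by
    apply tendsto_finsetProd
    intro k _
    by_cases hk : k < n - 1
    · simp only [hk, dite_true, if_true]
      have : Filter.Tendsto (fun a : Fin (n - 1) → ℂ => a ⟨k, hk⟩) (nhds 0) (nhds 0) :=
        (continuous_apply (⟨k, hk⟩ : Fin (n - 1))).tendsto (0 : Fin (n - 1) → ℂ)
      exact this.mono_left nhdsWithin_le_nhds
    · simp only [hk, dite_false, if_false]
      exact tendsto_const_nhds
  have h2 : (∏ k ∈ Finset.Ico i j, (if k < n - 1 then (0 : ℂ) else 1)) = 0 := by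
    apply Finset.prod_eq_zero (i := i)
    · simp [hij]
    · rw [if_pos (by omega)]
  rw [h2] at h1
  refine h1.congr' ?_
  filter_upwards [self_mem_nhdsWithin] with a ha
  rw [eq_div_iff (uOf_ne_zero n a ha j)]
  unfold uOf
  exact Finset.prod_Ico_consecutive _ hij.le (by omega)

lemma pval_lt {n : ℕ} (I : Equiv.Perm (Fin n)) {k : ℕ} (hk : k < n) : pval n I k < n := by
  simp [pval, hk]

lemma pval_inj {n : ℕ} (I : Equiv.Perm (Fin n)) {k j : ℕ} (hk : k < n) (hj : j < n)
    (h : pval n I k = pval n I j) : k = j := by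
  simp only [pval, hk, hj, dite_true] at h
  have := I.injective (Fin.ext h)
  simpa using this

/-- Limit weight. -/
def WW (n : ℕ) (I : Equiv.Perm (Fin n)) (q h : ℂ) (k j : ℕ) : ℂ :=
  if pval n I j < pval n I k then h / q else 1

/-- Limit factor. -/
def GG (c : ℤ → ℂ) (W : ℕ → ℕ → ℂ) (k j : ℕ) (D : ℤ) : ℂ :=
  (if k = j then c D else 1) * W k j ^ D

lemma RR_tendsto (n : ℕ) (I : Equiv.Perm (Fin n)) (q h : ℂ) (hq : q ≠ 0) (hh : h ≠ 0)
    (k j : ℕ) (hk : k < n) (hj : j < n) (D : ℤ) :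
    Filter.Tendsto (fun a : Fin (n - 1) → ℂ =>
        RR q h (uOf n a (pval n I k) / uOf n a (pval n I j)) D)
      (nhdsWithin 0 {a | ∀ i, a i ≠ 0}) (nhds (GG (cc q h) (WW n I q h) k j D)) := by
  unfold GG
  by_cases hkj : k = j
  · subst hkj
    have : (if k = k then cc q h D else 1) * WW n I q h k k ^ D = RR q h 1 D := by
      simp [WW, RR, cc]
    rw [this]
    refine tendsto_const_nhds.congr' ?_
    filter_upwards [self_mem_nhdsWithin] with a ha
    rw [div_self (uOf_ne_zero n a ha _)]
  · rw [if_neg hkj, one_mul]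
    rcases lt_or_gt_of_ne (fun e => hkj (pval_inj I hk hj e)) with hlt | hgt
    · rw [WW, if_neg (by omega), one_zpow]
      exact RR_tendsto_zero (uOf_ratio_tendsto n _ _ hlt (pval_lt I hj)) q h D
    · rw [WW, if_pos hgt]
      have h1 := uOf_ratio_tendsto n _ _ hgt (pval_lt I hk)
      have h2 : ∀ᶠ a in nhdsWithin (0 : Fin (n - 1) → ℂ) {a | ∀ i, a i ≠ 0},
          uOf n a (pval n I j) / uOf n a (pval n I k) ≠ 0 := by
        filter_upwards [self_mem_nhdsWithin] with a ha
        exact div_ne_zero (uOf_ne_zero n a ha _) (uOf_ne_zero n a ha _)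
      simpa only [inv_div] using RR_tendsto_infty h1 h2 q h hq hh D

lemma prod_pval {n : ℕ} (I : Equiv.Perm (Fin n)) (f : ℕ → ℂ) :
    ∏ i ∈ Finset.range n, f i = ∏ k ∈ Finset.range n, f (pval n I k) := by
  rw [Finset.prod_range, Finset.prod_range, ← Equiv.prod_comp I]
  refine Finset.prod_congr rfl fun i _ => ?_
  simp [pval]

lemma dd_top {n : ℕ} (d : Deg n) (k : ℕ) : dd n d (n - 1) k = 0 := by simp [dd]

lemma vTerm_eq (n : ℕ) (hn : 2 ≤ n) (I : Equiv.Perm (Fin n)) (q h : ℂ) (u : ℕ → ℂ) (d : Deg n) :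
    vTerm n I q h u d = ∏ i ∈ Finset.range (n - 1), ∏ j ∈ Finset.range (i + 1),
      ((∏ k ∈ Finset.range (i + 2), RR q h (u (pval n I k) / u (pval n I j))
          ((dd n d i j : ℤ) - dd n d (i + 1) k)) *
        ∏ k ∈ Finset.range (i + 1), (RR q h (u (pval n I k) / u (pval n I j))
          ((dd n d i j : ℤ) - dd n d i k))⁻¹) := by
  have h3 : (∏ i ∈ Finset.range n, ∏ j ∈ Finset.range (n - 1),
      qPoch q (h * u i / u (pval n I j)) (dd n d (n - 2) j) /
        qPoch q (q * u i / u (pval n I j)) (dd n d (n - 2) j)) =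
      ∏ j ∈ Finset.range (n - 2 + 1), ∏ k ∈ Finset.range (n - 2 + 2),
        RR q h (u (pval n I k) / u (pval n I j))
          ((dd n d (n - 2) j : ℤ) - dd n d (n - 2 + 1) k) := by
    rw [Finset.prod_comm, show n - 2 + 1 = n - 1 by omega, show n - 2 + 2 = n by omega]
    refine Finset.prod_congr rfl fun j _ => ?_
    rw [prod_pval I]
    refine Finset.prod_congr rfl fun k _ => ?_
    rw [dd_top, RR, mul_div_assoc, mul_div_assoc]
    simp
  simp only [Finset.prod_mul_distrib]
  unfold vTerm
  rw [h3, mul_right_comm]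
  congr 1
  · conv_rhs => rw [show n - 1 = n - 2 + 1 by omega, Finset.prod_range_succ]
    simp only [RR, mul_div_assoc]
  · simp only [RR, mul_div_assoc, inv_div]

/-- The limiting coefficient, in raw form. -/
def Lraw (n : ℕ) (I : Equiv.Perm (Fin n)) (q h : ℂ) (d : Deg n) : ℂ :=
  ∏ i ∈ Finset.range (n - 1), ∏ j ∈ Finset.range (i + 1),
      ((∏ k ∈ Finset.range (i + 2), GG (cc q h) (WW n I q h) k j
          ((dd n d i j : ℤ) - dd n d (i + 1) k)) *
        ∏ k ∈ Finset.range (i + 1), (GG (cc q h) (WW n I q h) k j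
          ((dd n d i j : ℤ) - dd n d i k))⁻¹)

lemma WW_ne (n : ℕ) (I : Equiv.Perm (Fin n)) (q h : ℂ) (hq : q ≠ 0) (hh : h ≠ 0) (k j : ℕ) :
    WW n I q h k j ≠ 0 := by
  unfold WW
  split_ifs
  · exact div_ne_zero hh hq
  · exact one_ne_zero

lemma vTerm_tendsto (n : ℕ) (hn : 2 ≤ n) (I : Equiv.Perm (Fin n)) (q h : ℂ) (hq : q ≠ 0)
    (hh : h ≠ 0) (d : Deg n) :
    Filter.Tendsto (fun a : Fin (n - 1) → ℂ => vTerm n I q h (uOf n a) d)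
          (nhdsWithin 0 {a | ∀ i, a i ≠ 0}) (nhds (Lraw n I q h d)) := by
  simp only [vTerm_eq n hn, Lraw]
  refine tendsto_finsetProd _ fun i hi => tendsto_finsetProd _ fun j hj => ?_
  rw [Finset.mem_range] at hi hj
  refine (tendsto_finsetProd _ fun k hk => ?_).mul (tendsto_finsetProd _ fun k hk => ?_)
  · rw [Finset.mem_range] at hk
    exact RR_tendsto n I q h hq hh k j (by omega) (by omega) _
  · rw [Finset.mem_range] at hk
    refine (RR_tendsto n I q h hq hh k j (by omega) (by omega) _).inv₀ ?_
    unfold GG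
    refine mul_ne_zero ?_ (zpow_ne_zero _ (WW_ne n I q h hq hh k j))
    split_ifs with e
    · rw [e, sub_self, cc_zero]; exact one_ne_zero
    · exact one_ne_zero

lemma inner_eq (c : ℤ → ℂ) (hc : c 0 = 1) (W : ℕ → ℕ → ℂ) (hW : ∀ k j, W k j ≠ 0)
    (D : ℕ → ℕ → ℕ) (i j : ℕ) (hj : j < i + 1) :
    ((∏ k ∈ Finset.range (i + 2), GG c W k j ((D i j : ℤ) - D (i + 1) k)) *
        ∏ k ∈ Finset.range (i + 1), (GG c W k j ((D i j : ℤ) - D i k))⁻¹) =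
    c ((D i j : ℤ) - D (i + 1) j) * W (i + 1) j ^ D i j *
      (∏ k ∈ Finset.range (i + 1), W k j ^ D i k) / ∏ k ∈ Finset.range (i + 2), W k j ^ D (i + 1) k
      := by
  have e1 : (∏ k ∈ Finset.range (i + 2), GG c W k j ((D i j : ℤ) - D (i + 1) k)) =
      c ((D i j : ℤ) - D (i + 1) j) * ((∏ k ∈ Finset.range (i + 2), W k j ^ D i j) /
        ∏ k ∈ Finset.range (i + 2), W k j ^ D (i + 1) k) := by
    unfold GG
    rw [Finset.prod_mul_distrib, Finset.prod_ite_eq' , if_pos (by simp; omega),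
      ← Finset.prod_div_distrib]
    congr 1
    refine Finset.prod_congr rfl fun k _ => ?_
    rw [zpow_sub₀ (hW k j), zpow_natCast, zpow_natCast]
  have e2 : ∏ k ∈ Finset.range (i + 1), (GG c W k j ((D i j : ℤ) - D i k))⁻¹ =
      (∏ k ∈ Finset.range (i + 1), W k j ^ D i k) / ∏ k ∈ Finset.range (i + 1), W k j ^ D i j := by
    rw [← Finset.prod_div_distrib]
    refine Finset.prod_congr rfl fun k _ => ?_
    have : (if k = j then c ((D i j : ℤ) - D i k) else 1) = 1 := by
      split_ifs with e
      · rw [e, sub_self, hc]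
      · rfl
    rw [GG, this, one_mul, zpow_sub₀ (hW k j), zpow_natCast, zpow_natCast, inv_div]
  have n1 : ∏ k ∈ Finset.range (i + 1), W k j ^ D i j ≠ 0 :=
    Finset.prod_ne_zero_iff.mpr fun k _ => pow_ne_zero _ (hW k j)
  rw [e1, e2, Finset.prod_range_succ (fun k => W k j ^ D i j) (i + 1)]
  generalize ∏ k ∈ Finset.range (i + 1), W k j ^ D i j = A at *
  field_simp

lemma closed_aux (c : ℤ → ℂ) (hc : c 0 = 1) (W : ℕ → ℕ → ℂ) (hW : ∀ k j, W k j ≠ 0)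
    (hW1 : ∀ k, W k k = 1) (D : ℕ → ℕ → ℕ) (N : ℕ) :
    (∏ i ∈ Finset.range N, ∏ j ∈ Finset.range (i + 1),
      ((∏ k ∈ Finset.range (i + 2), GG c W k j ((D i j : ℤ) - D (i + 1) k)) *
        ∏ k ∈ Finset.range (i + 1), (GG c W k j ((D i j : ℤ) - D i k))⁻¹)) *
      (∏ j ∈ Finset.range (N + 1), ∏ k ∈ Finset.range (N + 1), W k j ^ D N k) =
    (∏ i ∈ Finset.range N, ∏ j ∈ Finset.range (i + 1),
      c ((D i j : ℤ) - D (i + 1) j) * (W (i + 1) j * W j i) ^ D i j) *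
      ∏ k ∈ Finset.range (N + 1), W k N ^ D N k := by
  induction N with
  | zero => simp [hW1]
  | succ N ih =>
    rw [Finset.prod_range_succ (fun i => ∏ j ∈ Finset.range (i + 1),
        ((∏ k ∈ Finset.range (i + 2), GG c W k j ((D i j : ℤ) - D (i + 1) k)) *
        ∏ k ∈ Finset.range (i + 1), (GG c W k j ((D i j : ℤ) - D i k))⁻¹)) N,
      Finset.prod_range_succ (fun i => ∏ j ∈ Finset.range (i + 1),
        c ((D i j : ℤ) - D (i + 1) j) * (W (i + 1) j * W j i) ^ D i j) N,
      Finset.prod_range_succ (fun j => ∏ k ∈ Finset.range (N + 1 + 1), W k j ^ D (N + 1) k) (N + 1)]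
    have e : ∏ j ∈ Finset.range (N + 1),
      ((∏ k ∈ Finset.range (N + 2), GG c W k j ((D N j : ℤ) - D (N + 1) k)) *
        ∏ k ∈ Finset.range (N + 1), (GG c W k j ((D N j : ℤ) - D N k))⁻¹) =
        (∏ j ∈ Finset.range (N + 1), c ((D N j : ℤ) - D (N + 1) j) * W (N + 1) j ^ D N j) *
        (∏ j ∈ Finset.range (N + 1), ∏ k ∈ Finset.range (N + 1), W k j ^ D N k) /
        ∏ j ∈ Finset.range (N + 1), ∏ k ∈ Finset.range (N + 2), W k j ^ D (N + 1) k := by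
      rw [← Finset.prod_mul_distrib, ← Finset.prod_div_distrib]
      exact Finset.prod_congr rfl fun j hj =>
        inner_eq c hc W hW D N j (Finset.mem_range.mp hj)
    have e2 : ∏ j ∈ Finset.range (N + 1),
        c ((D N j : ℤ) - D (N + 1) j) * (W (N + 1) j * W j N) ^ D N j =
        (∏ j ∈ Finset.range (N + 1), c ((D N j : ℤ) - D (N + 1) j) * W (N + 1) j ^ D N j) *
        ∏ j ∈ Finset.range (N + 1), W j N ^ D N j := by
      rw [← Finset.prod_mul_distrib]
      exact Finset.prod_congr rfl fun j _ => by rw [mul_pow]; ring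
    have nz : ∏ j ∈ Finset.range (N + 1), ∏ k ∈ Finset.range (N + 2), W k j ^ D (N + 1) k ≠ 0 :=
      Finset.prod_ne_zero_iff.mpr fun j _ => Finset.prod_ne_zero_iff.mpr fun k _ =>
        pow_ne_zero _ (hW k j)
    rw [e, e2]
    simp only [show N + 1 + 1 = N + 2 from rfl]
    generalize ∏ j ∈ Finset.range (N + 1), ∏ k ∈ Finset.range (N + 2), W k j ^ D (N + 1) k = B at *
    generalize ∏ k ∈ Finset.range (N + 2), W k (N + 1) ^ D (N + 1) k = C at *
    generalize ∏ j ∈ Finset.range (N + 1), c ((D N j : ℤ) - D (N + 1) j) * W (N + 1) j ^ D N j = E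
      at *
    rw [mul_assoc, div_mul_eq_mul_div, mul_comm B C, ← mul_assoc _ C B, mul_div_assoc, div_self nz]
    linear_combination E * C * ih

lemma Lraw_eq (n : ℕ) (I : Equiv.Perm (Fin n)) (q h : ℂ) (hq : q ≠ 0) (hh : h ≠ 0) (d : Deg n) :
    Lraw n I q h d = ∏ i ∈ Finset.range (n - 1), ∏ j ∈ Finset.range (i + 1),
      cc q h ((dd n d i j : ℤ) - dd n d (i + 1) j) *
        (WW n I q h (i + 1) j * WW n I q h j i) ^ dd n d i j := by
  have := closed_aux (cc q h) (cc_zero q h) (WW n I q h) (WW_ne n I q h hq hh)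
    (fun k => by simp [WW]) (dd n d) (n - 1)
  simpa [dd_top, Lraw] using this

/-! ### Summation -/

/-- Change of summation variables `d_{i,j} = ∑_{i' ≥ i} m_{i',j}`. -/
def Psi (n : ℕ) (m : Deg n) : Deg n := fun i j =>
  if (j : ℕ) ≤ (i : ℕ) then ∑ i' ∈ Finset.Ico (i : ℕ) (n - 1), dd n m i' j else m i j

lemma dd_coe {n : ℕ} (m : Deg n) (i j : Fin (n - 1)) : dd n m i j = m i j := by
  simp [dd]

lemma dd_ext {n : ℕ} {d d' : Deg n} (h : ∀ i j, i < n - 1 → j < n - 1 → dd n d i j = dd n d' i j) :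
    d = d' := by
  funext i j
  have h1 := h i j i.2 j.2
  have h2 := dd_coe d i j
  have h3 := dd_coe d' i j
  exact h2.symm.trans (h1.trans h3)

lemma dd_Psi (n : ℕ) (m : Deg n) (i j : ℕ) : dd n (Psi n m) i j =
    if j ≤ i then ∑ i' ∈ Finset.Ico i (n - 1), dd n m i' j else dd n m i j := by
  by_cases hj : j < n - 1
  · by_cases hi : i < n - 1
    · rw [dd, dif_pos ⟨hi, hj⟩]
      simp only [Psi]
      split_ifs
      · rfl
      · simp [dd, hi, hj]
    · have : Finset.Ico i (n - 1) = ∅ := Finset.Ico_eq_empty (by omega)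
      rw [this]
      simp [dd, hi]
  · simp [dd, hj]

lemma dd_Psi_succ (n : ℕ) (m : Deg n) (i j : ℕ) (hj : j ≤ i) (hi : i < n - 1) :
    dd n (Psi n m) i j = dd n m i j + dd n (Psi n m) (i + 1) j := by
  rw [dd_Psi, dd_Psi, if_pos hj, if_pos (by omega), Finset.sum_eq_sum_Ico_succ_bot hi]

lemma Psi_inj (n : ℕ) : Function.Injective (Psi n) := by
  intro m m' h
  apply dd_ext
  intro i j hi hj
  by_cases hji : j ≤ i
  · have h1 := dd_Psi_succ n m i j hji hi
    have h2 := dd_Psi_succ n m' i j hji hi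
    rw [h] at h1
    omega
  · have h1 := dd_Psi n m i j
    have h2 := dd_Psi n m' i j
    rw [if_neg hji] at h1 h2
    rw [← h1, ← h2, h]

lemma mem_range_Psi (n : ℕ) (d : Deg n)
    (hd : ∀ i j, i < n - 1 → j ≤ i → dd n d (i + 1) j ≤ dd n d i j) : d ∈ Set.range (Psi n) := by
  let m : Deg n := fun i j => if (j : ℕ) ≤ (i : ℕ) then d i j - dd n d (i + 1) j else d i j
  have hm : ∀ i j, i < n - 1 → j < n - 1 →
      dd n m i j = if j ≤ i then dd n d i j - dd n d (i + 1) j else dd n d i j := by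
    intro i j hi hj
    rw [dd, dif_pos ⟨hi, hj⟩, dd, dif_pos ⟨hi, hj⟩]
  refine ⟨m, ?_⟩
  have key : ∀ t i j, i + t = n - 1 → j ≤ i → j < n - 1 → dd n (Psi n m) i j = dd n d i j := by
    intro t
    induction t with
    | zero =>
      intro i j hi _ _
      have : i = n - 1 := by omega
      rw [this, dd_top, dd_top]
    | succ t ih =>
      intro i j hi hji hj
      rw [dd_Psi_succ n m i j hji (by omega), ih (i + 1) j (by omega) (by omega) hj,
        hm i j (by omega) hj, if_pos hji]
      have := hd i j (by omega) hji
      omega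
  apply dd_ext
  intro i j hi hj
  by_cases hji : j ≤ i
  · exact key (n - 1 - i) i j (by omega) hji hj
  · rw [dd_Psi, if_neg hji, hm i j hi hj, if_neg hji]

lemma tri_swap (M : ℕ) (f : ℕ → ℕ → ℕ → ℂ) :
    ∏ i ∈ Finset.range M, ∏ j ∈ Finset.range (i + 1), ∏ i' ∈ Finset.Ico i M, f i j i' =
    ∏ i' ∈ Finset.range M, ∏ j ∈ Finset.range (i' + 1), ∏ i ∈ Finset.Ico j (i' + 1), f i j i' := by
  rw [Finset.prod_comm' (t' := Finset.range M) (s' := fun j => Finset.Ico j M)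
    (by intro x y; simp only [Finset.mem_range, Finset.mem_Ico]; omega)]
  rw [Finset.prod_comm' (s := Finset.range M) (t := fun i' => Finset.range (i' + 1))
    (t' := Finset.range M) (s' := fun j => Finset.Ico j M)
    (by intro x y; simp only [Finset.mem_range, Finset.mem_Ico]; omega)]
  refine Finset.prod_congr rfl fun j _ => ?_
  exact Finset.prod_comm' (by intro x y; simp only [Finset.mem_Ico]; omega)

lemma chain_W (n : ℕ) (I : Equiv.Perm (Fin n)) (q h : ℂ) (j t : ℕ) (ht : j + t + 1 < n) :
    ∏ i ∈ Finset.Ico j (j + t + 1), (WW n I q h (i + 1) j * WW n I q h j i) =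
      (h / q) ^ (t + (if pval n I j < pval n I (j + t + 1) then 1 else 0)) := by
  have hW : ∀ k, WW n I q h k j = (h / q) ^ (if pval n I j < pval n I k then 1 else 0) := by
    intro k
    unfold WW
    split_ifs <;> simp
  induction t with
  | zero =>
    simp only [add_zero, Nat.Ico_succ_singleton, Finset.prod_singleton]
    rw [hW (j + 1), show WW n I q h j j = 1 by simp [WW], zero_add, mul_one]
  | succ t ih =>
    rw [show j + (t + 1) + 1 = (j + t + 1) + 1 by ring, Finset.prod_Ico_succ_top (by omega),
      ih (by omega), pow_add, pow_add, ← hW, ← hW]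
    have : WW n I q h (j + t + 1) j * WW n I q h j (j + t + 1) = h / q := by
      have hne : pval n I j ≠ pval n I (j + t + 1) := fun e => by
        have := pval_inj I (by omega) (by omega) e
        omega
      unfold WW
      rcases lt_or_gt_of_ne hne with hl | hl
      · rw [if_pos hl, if_neg (by omega), mul_one]
      · rw [if_neg (by omega), if_pos hl, one_mul]
    rw [pow_succ]
    linear_combination ((h / q) ^ t * WW n I q h (j + t + 1 + 1) j) * this

lemma prod_pairsN (n : ℕ) (hn : 1 ≤ n) (g : ℕ × ℕ → ℂ) : ∏ p ∈ pairsN n, g p =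
    ∏ i ∈ Finset.range (n - 1), ∏ j ∈ Finset.range (i + 1), g (j, i + 1) := by
  unfold pairsN
  rw [Finset.prod_filter, Finset.prod_product_right]
  conv_lhs => rw [show n = n - 1 + 1 by omega, Finset.prod_range_succ']
  simp only [Nat.not_lt_zero, if_false, Finset.prod_const_one, mul_one]
  refine Finset.prod_congr rfl fun i hi => ?_
  rw [Finset.mem_range] at hi
  rw [← Finset.prod_filter]
  refine Finset.prod_congr ?_ fun _ _ => rfl
  ext j
  simp only [Finset.mem_filter, Finset.mem_range]
  omega

lemma term_eq (n : ℕ) (I : Equiv.Perm (Fin n)) (q h : ℂ) (hq : q ≠ 0) (hh : h ≠ 0) (Z : ℕ → ℂ)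
    (d : Deg n) :
    Lraw n I q h d * zMon n Z d = ∏ i ∈ Finset.range (n - 1), ∏ j ∈ Finset.range (i + 1),
      cc q h ((dd n d i j : ℤ) - dd n d (i + 1) j) *
        (Z i * (WW n I q h (i + 1) j * WW n I q h j i)) ^ dd n d i j := by
  rw [Lraw_eq n I q h hq hh, zMon, ← Finset.prod_mul_distrib]
  refine Finset.prod_congr rfl fun i _ => ?_
  rw [← Finset.prod_pow_eq_pow_sum, ← Finset.prod_mul_distrib]
  refine Finset.prod_congr rfl fun j _ => ?_
  rw [mul_pow (Z i)]
  ring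

lemma main_sum (n : ℕ) (I : Equiv.Perm (Fin n)) (q h : ℂ) (hq : q ≠ 0) (hq1 : ‖q‖ < 1)
    (hh : h ≠ 0) (Z : ℕ → ℂ) (X : ℕ → ℕ → ℂ)
    (hX : ∀ i j, X i j = ∏ t ∈ Finset.Ico j (i + 1), Z t * (WW n I q h (t + 1) j * WW n I q h j t))
    (hX1 : ∀ i j, i < n - 1 → j ≤ i → ‖X i j‖ < 1) :
    HasSum (fun d : Deg n => Set.indicator {d : Deg n | admissible n d}
        (fun d => Lraw n I q h d * zMon n Z d) d)
      (∏ i ∈ Finset.range (n - 1), ∏ j ∈ Finset.range (i + 1),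
        phiP q (h * X i j) / phiP q (X i j)) := by
  classical
  let F : ℕ → ℕ → ℕ → ℂ := fun i j m =>
    if j ≤ i then cc q h (m : ℤ) * X i j ^ m else if m = 0 then 1 else 0
  let S : ℕ → ℕ → ℂ := fun i j => if j ≤ i then phiP q (h * X i j) / phiP q (X i j) else 1
  have hFS : ∀ i j, i < n - 1 → HasSum (F i j) (S i j) := by
    intro i j hi
    by_cases hji : j ≤ i
    · simp only [F, S, hji, if_true]
      exact qbinomial q h _ hq1 (hX1 i j hi hji)
    · simp only [F, S, hji, if_false]
      exact hasSum_ite_eq 0 1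
  have h1 : HasSum (fun m : Deg n => ∏ i : Fin (n - 1), ∏ j : Fin (n - 1), F i j (m i j))
      (∏ i : Fin (n - 1), ∏ j : Fin (n - 1), S i j) :=
    hasSum_pi_prod (n - 1) (fun i (v : Fin (n - 1) → ℕ) => ∏ j : Fin (n - 1), F i j (v j))
      (fun i => ∏ j : Fin (n - 1), S i j)
      (fun i => hasSum_pi_prod (n - 1) (fun j => F i j) (fun j => S i j) (fun j => hFS i j i.2))
  have hcut : ∀ (T : ℕ → ℕ → ℂ), (∀ i j, i < n - 1 → j < n - 1 → ¬ j ≤ i → T i j = 1) →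
      ∏ i : Fin (n - 1), ∏ j : Fin (n - 1), T i j =
        ∏ i ∈ Finset.range (n - 1), ∏ j ∈ Finset.range (i + 1), T i j := by
    intro T hT
    rw [Finset.prod_range]
    refine Finset.prod_congr rfl fun i _ => ?_
    rw [← Finset.prod_range (fun j => T i j)]
    symm
    apply Finset.prod_subset
    · intro j hj
      rw [Finset.mem_range] at hj ⊢
      have := i.2
      omega
    · intro j hj hj'
      rw [Finset.mem_range] at hj hj'
      exact hT i j i.2 hj (by omega)
  have hSeq : ∏ i : Fin (n - 1), ∏ j : Fin (n - 1), S i j =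
      ∏ i ∈ Finset.range (n - 1), ∏ j ∈ Finset.range (i + 1),
        phiP q (h * X i j) / phiP q (X i j) := by
    rw [hcut S (fun i j _ _ hji => by simp [S, hji])]
    refine Finset.prod_congr rfl fun i _ => Finset.prod_congr rfl fun j hj => ?_
    rw [Finset.mem_range] at hj
    simp only [S]
    rw [if_pos (by omega)]
  rw [hSeq] at h1
  rw [← (Psi_inj n).hasSum_iff]
  · have he : ((fun d : Deg n => Set.indicator {d : Deg n | admissible n d}
        (fun d => Lraw n I q h d * zMon n Z d) d) ∘ Psi n) =
        fun m : Deg n => ∏ i : Fin (n - 1), ∏ j : Fin (n - 1), F i j (m i j) := by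
      funext m
      simp only [Function.comp]
      by_cases hm : ∃ i j : Fin (n - 1), (i : ℕ) < j ∧ m i j ≠ 0
      · obtain ⟨i, j, hij, hmij⟩ := hm
        rw [Set.indicator_of_notMem]
        · symm
          apply Finset.prod_eq_zero (Finset.mem_univ i)
          apply Finset.prod_eq_zero (Finset.mem_univ j)
          simp only [F]
          rw [if_neg (by omega), if_neg hmij]
        · intro hadm
          have h2 := hadm.1 i j hij
          rw [dd_Psi, if_neg (by omega), dd_coe] at h2
          exact hmij h2
      · push Not at hm
        have hadm : admissible n (Psi n m) := by
          refine ⟨?_, ?_⟩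
          · intro i j hij
            rw [dd_Psi, if_neg (by omega)]
            unfold dd
            split_ifs with hlt
            · exact hm _ _ hij
            · rfl
          · intro i hi
            refine ⟨id, Set.injOn_id _, fun k hk => ⟨by simp only [id]; omega, ?_⟩⟩
            have := dd_Psi_succ n m i k (by omega) (by omega)
            simp only [id]
            omega
        rw [Set.indicator_of_mem (s := {d : Deg n | admissible n d}) hadm, term_eq n I q h hq hh]
        have e1 : ∏ i : Fin (n - 1), ∏ j : Fin (n - 1), F i j (m i j) =
            ∏ i ∈ Finset.range (n - 1), ∏ j ∈ Finset.range (i + 1), F i j (dd n m i j) := by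
          rw [← hcut (fun i j => F i j (dd n m i j))]
          · simp only [dd_coe]
          · intro i j hi hj hji
            have : dd n m i j = 0 := by
              rw [dd, dif_pos ⟨hi, hj⟩]
              exact hm ⟨i, hi⟩ ⟨j, hj⟩ (by simpa using hji)
            simp only [F]
            rw [if_neg hji, if_pos this]
        rw [e1]
        have e2 : ∀ i ∈ Finset.range (n - 1), ∀ j ∈ Finset.range (i + 1),
            F i j (dd n m i j) = cc q h (dd n m i j : ℤ) *
              ∏ t ∈ Finset.Ico j (i + 1),
                (Z t * (WW n I q h (t + 1) j * WW n I q h j t)) ^ dd n m i j := by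
          intro i _ j hj
          rw [Finset.mem_range] at hj
          simp only [F]
          rw [if_pos (by omega), hX, Finset.prod_pow]
        have e3 : ∀ i ∈ Finset.range (n - 1), ∀ j ∈ Finset.range (i + 1),
            cc q h ((dd n (Psi n m) i j : ℤ) - dd n (Psi n m) (i + 1) j) *
              (Z i * (WW n I q h (i + 1) j * WW n I q h j i)) ^ dd n (Psi n m) i j =
            cc q h (dd n m i j : ℤ) * ∏ i' ∈ Finset.Ico i (n - 1),
              (Z i * (WW n I q h (i + 1) j * WW n I q h j i)) ^ dd n m i' j := by
          intro i hi j hj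
          rw [Finset.mem_range] at hi hj
          have h2 := dd_Psi_succ n m i j (by omega) hi
          have h3 : (dd n (Psi n m) i j : ℤ) - dd n (Psi n m) (i + 1) j = dd n m i j := by omega
          rw [h3, dd_Psi, if_pos (by omega), Finset.prod_pow_eq_pow_sum]
        rw [Finset.prod_congr rfl fun i hi => Finset.prod_congr rfl (e2 i hi),
          Finset.prod_congr rfl fun i hi => Finset.prod_congr rfl (e3 i hi)]
        simp only [Finset.prod_mul_distrib]
        congr 1
        exact tri_swap (n - 1) (fun i j i' =>
          (Z i * (WW n I q h (i + 1) j * WW n I q h j i)) ^ dd n m i' j)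
    rw [he]
    exact h1
  · intro d hd
    by_contra hne
    apply hd
    have hadm : admissible n d := by
      by_contra hna
      apply hne
      exact Set.indicator_of_notMem (s := {d : Deg n | admissible n d}) hna _
    rw [Set.indicator_of_mem (s := {d : Deg n | admissible n d}) hadm, term_eq n I q h hq hh] at hne
    apply mem_range_Psi
    intro i j hi hji
    have h2 := Finset.prod_ne_zero_iff.mp (Finset.prod_ne_zero_iff.mp hne i (Finset.mem_range.mpr hi))
      j (Finset.mem_range.mpr (by omega))
    by_contra hlt
    exact h2 (by rw [cc_neg q h hq _ (by omega), zero_mul])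

/-- The limit of the vertex function of the cotangent bundle of the complete flag
variety as the equivariant parameters go to `0` along the chamber (Proposition
`limver` of the paper): every coefficient `c_d(a)` of `z^d` in `V_I(u,z)` is a rational
function of `a_1,…,a_{n-1}` over `ℚ(q,ħ)`, its limit `c_d(0)` as `a → 0` exists, and
`∑_{d∈C} c_d(0) z^d = ∏_{1≤j<k≤n} φ(q(ħ/q)^{k−j+δ(I_j<I_k)} z_j⋯z_{k−1}) /
φ((ħ/q)^{k−j−1+δ(I_j<I_k)} z_j⋯z_{k−1})`. -/
theorem vertex_function_limit
    (n : ℕ) (hn : 2 ≤ n) (I : Equiv.Perm (Fin n)) (q h : ℂ)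
    (hq0 : 0 < ‖q‖) (hq1 : ‖q‖ < 1)
    (hh : h ≠ 0) (hgen : ∀ k : ℤ, h ≠ q ^ k) :
    ∃ L : Deg n → ℂ,
      (∀ d : Deg n, admissible n d →
        (∃ P Q : MvPolynomial (Fin (n - 1)) ℂ,
          (∀ m, MvPolynomial.coeff m P ∈ Algebra.adjoin ℚ ({q, h} : Set ℂ)) ∧
          (∀ m, MvPolynomial.coeff m Q ∈ Algebra.adjoin ℚ ({q, h} : Set ℂ)) ∧
          Q ≠ 0 ∧
          ∀ a : Fin (n - 1) → ℂ, MvPolynomial.eval a Q ≠ 0 →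
            vTerm n I q h (uOf n a) d * MvPolynomial.eval a Q = MvPolynomial.eval a P) ∧
        Filter.Tendsto (fun a : Fin (n - 1) → ℂ => vTerm n I q h (uOf n a) d)
          (nhdsWithin 0 {a | ∀ i, a i ≠ 0}) (nhds (L d))) ∧
      (∃ r : ℝ, 0 < r ∧ ∀ z : Fin (n - 1) → ℂ, (∀ i, ‖z i‖ < r) →
        HasSum
          (fun d : Deg n =>
            Set.indicator {d : Deg n | admissible n d}
              (fun d => L d * zMon n (fun i => if hi : i < n - 1 then z ⟨i, hi⟩ else 0) d) d)
          (∏ p ∈ pairsN n,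
            phiP q (q * (h / q) ^ (p.2 - p.1 +
                (if pval n I p.1 < pval n I p.2 then 1 else 0)) *
                ∏ k ∈ Finset.Ico p.1 p.2, (if hk : k < n - 1 then z ⟨k, hk⟩ else 1)) /
            phiP q ((h / q) ^ (p.2 - p.1 - 1 +
                (if pval n I p.1 < pval n I p.2 then 1 else 0)) *
                ∏ k ∈ Finset.Ico p.1 p.2, (if hk : k < n - 1 then z ⟨k, hk⟩ else 1)))) := by
  have hq : q ≠ 0 := norm_pos_iff.mp hq0
  refine ⟨Lraw n I q h, ?_, ?_⟩
  · intro d _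
    exact ⟨IsRat.vTerm n I (Algebra.subset_adjoin (by simp)) (Algebra.subset_adjoin (by simp)) d,
      vTerm_tendsto n hn I q h hq hh d⟩
  · set K : ℝ := max 1 ‖h / q‖ ^ n with hK
    have hm1 : (1 : ℝ) ≤ max 1 ‖h / q‖ := le_max_left _ _
    have hK1 : 1 ≤ K := one_le_pow₀ hm1
    have hKpos : 0 < K := by linarith
    refine ⟨K⁻¹, inv_pos.mpr hKpos, ?_⟩
    intro z hz
    set Z : ℕ → ℂ := fun i => if hi : i < n - 1 then z ⟨i, hi⟩ else 0 with hZ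
    have hclosed : ∀ i j, i < n - 1 → j ≤ i →
        ∏ t ∈ Finset.Ico j (i + 1), Z t * (WW n I q h (t + 1) j * WW n I q h j t) =
        (h / q) ^ (i + 1 - j - 1 + (if pval n I j < pval n I (i + 1) then 1 else 0)) *
          ∏ k ∈ Finset.Ico j (i + 1), (if hk : k < n - 1 then z ⟨k, hk⟩ else 1) := by
      intro i j hi hji
      obtain ⟨t, rfl⟩ := Nat.exists_eq_add_of_le hji
      rw [Finset.prod_mul_distrib, chain_W n I q h j t (by omega), mul_comm,
        show j + t + 1 - j - 1 = t by omega]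
      congr 1
      refine Finset.prod_congr rfl fun k hk => ?_
      rw [Finset.mem_Ico] at hk
      have hk' : k < n - 1 := by omega
      simp only [hZ, hk', dite_true]
    have hsum := main_sum n I q h hq hq1 hh Z
      (fun i j => ∏ t ∈ Finset.Ico j (i + 1), Z t * (WW n I q h (t + 1) j * WW n I q h j t))
      (fun i j => rfl) (by
        intro i j hi hji
        simp only [hclosed i j hi hji]
        rw [norm_mul, norm_pow, norm_prod]
        have b1 : ‖h / q‖ ^ (i + 1 - j - 1 + (if pval n I j < pval n I (i + 1) then 1 else 0)) ≤ K :=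
          calc _ ≤ (max 1 ‖h / q‖) ^ (i + 1 - j - 1 +
                (if pval n I j < pval n I (i + 1) then 1 else 0)) :=
                pow_le_pow_left₀ (norm_nonneg _) (le_max_right _ _) _
            _ ≤ K := pow_le_pow_right₀ hm1 (by split_ifs <;> omega)
        have b2 : ∏ k ∈ Finset.Ico j (i + 1), ‖(if hk : k < n - 1 then z ⟨k, hk⟩ else 1 : ℂ)‖
            < K⁻¹ := by
          rw [← Finset.mul_prod_Ioo_eq_prod_Ico (by omega)]
          have c1 : ‖(if hk : j < n - 1 then z ⟨j, hk⟩ else 1 : ℂ)‖ < K⁻¹ := by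
            rw [dif_pos (by omega)]; exact hz _
          have c2 : ∏ k ∈ Finset.Ioo j (i + 1), ‖(if hk : k < n - 1 then z ⟨k, hk⟩ else 1 : ℂ)‖
              ≤ 1 := by
            apply Finset.prod_le_one
            · intro k _; exact norm_nonneg _
            · intro k _
              split_ifs
              · exact (hz _).le.trans (inv_le_one_of_one_le₀ hK1)
              · simp
          exact (mul_le_of_le_one_right (norm_nonneg _) c2).trans_lt c1
        calc _ ≤ K * ∏ k ∈ Finset.Ico j (i + 1), ‖(if hk : k < n - 1 then z ⟨k, hk⟩ else 1 : ℂ)‖ :=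
              mul_le_mul_of_nonneg_right b1 (Finset.prod_nonneg fun k _ => norm_nonneg _)
          _ < K * K⁻¹ := mul_lt_mul_of_pos_left b2 hKpos
          _ = 1 := mul_inv_cancel₀ hKpos.ne')
    rw [prod_pairsN n (by omega)]
    convert hsum using 1
    refine Finset.prod_congr rfl fun i hi => Finset.prod_congr rfl fun j hj => ?_
    rw [Finset.mem_range] at hi hj
    have hji : j ≤ i := by omega
    simp only [hclosed i j hi hji]
    congr 2
    rw [show i + 1 - j + (if pval n I j < pval n I (i + 1) then 1 else 0) =
      (i + 1 - j - 1 + (if pval n I j < pval n I (i + 1) then 1 else 0)) + 1 by omega, pow_succ]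
    field_simp
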